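/- Let f : ℝ → ℝ be a continuous odd function, F(s) = ∫₀^s f(t) dt, and assume (H₁): there are s₀ > 0 and M > 0 with 0 < F(s) ≤ M|f(s)| for all |s| ≥ s₀, and (H₂): 0 < F(s) ≤ (1/2) f(s) s for all s ≠ 0. Fix m ∈ ℕ, m ≥ 1, let A_m = { x = (x₁,x₂) ∈ B : cos(π/2^m)·|x₁| < sin(π/2^m)·x₂ } where B is the open unit ball of ℝ², and define I(u) = (1/2)∫_{A_m} ‖∇u‖² − ∫_{A_m} F(u) for smooth u with compact support in A_m. Then for every r > 0 there exists a smooth function e : ℝ² → ℝ with compact support in A_m such that ∫_{A_m} ‖∇e‖² > r² and I(e) < 0. -/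

import Mathlib

open MeasureTheory Real Filter Metric Set
open scoped Topology RealInnerProductSpace

/-- `primF f s = ∫₀^s f(t) dt`. -/
noncomputable def primF (f : ℝ → ℝ) (s : ℝ) : ℝ := ∫ t in (0:ℝ)..s, f t

/-- The angular sector `A_m = {x ∈ B : cos(π/2^m)·|x₁| < sin(π/2^m)·x₂}` of the
open unit ball `B ⊂ ℝ²`. -/
def sector (m : ℕ) : Set (EuclideanSpace ℝ (Fin 2)) :=
  {x | x ∈ ball (0 : EuclideanSpace ℝ (Fin 2)) 1 ∧
    Real.cos (π / 2 ^ m) * |x 0| < Real.sin (π / 2 ^ m) * x 1}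

/-- The energy functional `I(u) = (1/2)∫_{A_m} ‖∇u‖² − ∫_{A_m} F(u)`. -/
noncomputable def energy (f : ℝ → ℝ) (m : ℕ) (u : EuclideanSpace ℝ (Fin 2) → ℝ) : ℝ :=
  (1/2) * (∫ x in sector m, ‖gradient u x‖ ^ 2) - ∫ x in sector m, primF f (u x)

theorem primF_zero (f : ℝ → ℝ) : primF f 0 = 0 := by
  simp [primF]

theorem hasDerivAt_primF {f : ℝ → ℝ} (hf : Continuous f) (s : ℝ) :
    HasDerivAt (primF f) (f s) s :=
  intervalIntegral.integral_hasDerivAt_right (hf.intervalIntegrable _ _)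
    hf.stronglyMeasurable.stronglyMeasurableAtFilter hf.continuousAt

theorem continuous_primF {f : ℝ → ℝ} (hf : Continuous f) : Continuous (primF f) :=
  continuous_iff_continuousAt.2 fun s => (hasDerivAt_primF hf s).continuousAt

/-- A differentiable function satisfying `F ≤ M F'` on `[s₀, ∞)` grows at least like
`exp (s / M)`. -/
theorem mul_exp_le_of_le_mul_deriv {F F' : ℝ → ℝ} {s₀ M : ℝ} (hM : 0 < M)
    (hF : ∀ s, HasDerivAt F (F' s) s) (hle : ∀ s, s₀ ≤ s → F s ≤ M * F' s)
    {s : ℝ} (hs : s₀ ≤ s) :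
    F s₀ * Real.exp (-(M⁻¹ * s₀)) * Real.exp (M⁻¹ * s) ≤ F s := by
  have hd : ∀ t, HasDerivAt (fun t => F t * Real.exp (-(M⁻¹ * t)))
      (F' t * Real.exp (-(M⁻¹ * t)) + F t * (Real.exp (-(M⁻¹ * t)) * (-(M⁻¹ * 1)))) t := fun t =>
    (hF t).mul (((hasDerivAt_id t).const_mul M⁻¹).neg.exp)
  have hmono : MonotoneOn (fun t => F t * Real.exp (-(M⁻¹ * t))) (Ici s₀) := by
    refine monotoneOn_of_deriv_nonneg (convex_Ici _)
      (fun t _ => (hd t).continuousAt.continuousWithinAt)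
      (fun t _ => (hd t).differentiableAt.differentiableWithinAt) fun t ht => ?_
    rw [interior_Ici] at ht
    have h1 : M⁻¹ * F t ≤ F' t := by
      rw [inv_mul_le_iff₀ hM]
      exact hle t (le_of_lt ht)
    rw [(hd t).deriv]
    nlinarith [mul_nonneg (sub_nonneg.2 h1) (Real.exp_pos (-(M⁻¹ * t))).le]
  calc F s₀ * Real.exp (-(M⁻¹ * s₀)) * Real.exp (M⁻¹ * s)
      ≤ F s * Real.exp (-(M⁻¹ * s)) * Real.exp (M⁻¹ * s) :=
        mul_le_mul_of_nonneg_right (hmono self_mem_Ici hs hs) (Real.exp_pos _).le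
    _ = F s := by rw [mul_assoc, ← Real.exp_add]; simp

theorem isOpen_sector (m : ℕ) : IsOpen (sector m) :=
  isOpen_ball.inter (isOpen_lt
    (f := fun x : EuclideanSpace ℝ (Fin 2) => Real.cos (π / 2 ^ m) * |x 0|)
    (g := fun x => Real.sin (π / 2 ^ m) * x 1) (by fun_prop) (by fun_prop))

theorem sector_nonempty {m : ℕ} (hm : 1 ≤ m) : (sector m).Nonempty := by
  have h2 : (1 : ℝ) < 2 ^ m := one_lt_pow₀ one_lt_two (by lia)
  have hsin : 0 < Real.sin (π / 2 ^ m) :=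
    Real.sin_pos_of_pos_of_lt_pi (by positivity) (div_lt_self pi_pos h2)
  refine ⟨EuclideanSpace.single 1 (1 / 2), ?_, ?_⟩
  · rw [mem_ball_zero_iff, PiLp.norm_single]
    norm_num
  · simpa using hsin

section Gradient

variable {E : Type*} [NormedAddCommGroup E] [InnerProductSpace ℝ E] [CompleteSpace E]

theorem norm_gradient (u : E → ℝ) (x : E) : ‖gradient u x‖ = ‖fderiv ℝ u x‖ :=
  (InnerProductSpace.toDual ℝ E).symm.norm_map _

/-- The Dirichlet integral of a nonzero compactly supported function is positive. -/
theorem integral_norm_gradient_sq_pos [MeasurableSpace E] [BorelSpace E] [FiniteDimensional ℝ E]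
    [Nontrivial E] {μ : Measure E} [μ.IsOpenPosMeasure] [IsFiniteMeasureOnCompacts μ]
    {u : E → ℝ} (hu : ContDiff ℝ 1 u) (hc : HasCompactSupport u) (hne : u ≠ 0) :
    0 < ∫ x, ‖gradient u x‖ ^ 2 ∂μ := by
  obtain ⟨x, hx⟩ : ∃ x, fderiv ℝ u x ≠ 0 := by
    by_contra! h
    obtain ⟨y, hy⟩ : ∃ y, y ∉ tsupport u := by
      by_contra! hy
      exact noncompact_univ E (eq_univ_of_forall hy ▸ hc)
    refine hne (funext fun x => ?_)
    rw [is_const_of_fderiv_eq_zero (hu.differentiable one_ne_zero) h x y]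
    exact image_eq_zero_of_notMem_tsupport hy
  simp_rw [norm_gradient]
  refine Continuous.integral_pos_of_hasCompactSupport_nonneg_nonzero (x := x)
    ((hu.continuous_fderiv one_ne_zero).norm.pow 2) ?_ (fun _ => by positivity)
    (by simpa using hx)
  exact (hc.fderiv ℝ).comp_left (g := fun L : E →L[ℝ] ℝ => ‖L‖ ^ 2) (by simp)

end Gradient

/-- mountain pass geometry, part (b): under (H₁), (H₂), for every
`r > 0` there is a smooth compactly supported `e` with Dirichlet norm `> r` and
`I(e) < 0`. -/
theorem mountain_pass_geometry_b
    (f : ℝ → ℝ) (hcont : Continuous f) (hodd : ∀ s : ℝ, f (-s) = - f s)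
    (hH1 : ∃ s₀ > 0, ∃ M > 0, ∀ s : ℝ, s₀ ≤ |s| → 0 < primF f s ∧ primF f s ≤ M * |f s|)
    (hH2 : ∀ s : ℝ, s ≠ 0 → 0 < primF f s ∧ primF f s ≤ (1/2) * f s * s)
    (m : ℕ) (hm : 1 ≤ m) :
    ∀ r > 0, ∃ e : EuclideanSpace ℝ (Fin 2) → ℝ,
      ContDiff ℝ (⊤ : ℕ∞) e ∧ HasCompactSupport e ∧ tsupport e ⊆ sector m ∧
      r ^ 2 < (∫ x in sector m, ‖gradient e x‖ ^ 2) ∧ energy f m e < 0 := by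
  intro r _
  have hFnonneg : ∀ s, 0 ≤ primF f s := fun s => by
    rcases eq_or_ne s 0 with rfl | hs
    · rw [primF_zero]
    · exact (hH2 s hs).1.le
  obtain ⟨s₀, hs₀, M, hM, hH1⟩ := hH1
  have hfpos : ∀ s, 0 < s → 0 < f s := fun s hs => by
    obtain ⟨h1, h2⟩ := hH2 s hs.ne'
    have h3 : 0 < f s * s := by linarith
    exact pos_of_mul_pos_left h3 hs.le
  have hgrowth : ∀ s, s₀ ≤ s →
      primF f s₀ * Real.exp (-(M⁻¹ * s₀)) * Real.exp (M⁻¹ * s) ≤ primF f s := fun s hs =>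
    mul_exp_le_of_le_mul_deriv hM (hasDerivAt_primF hcont) (fun t ht => by
      have h := (hH1 t (ht.trans (le_abs_self t))).2
      rwa [abs_of_pos (hfpos t (hs₀.trans_le ht))] at h) hs
  obtain ⟨p, hp⟩ := sector_nonempty hm
  obtain ⟨ρ, hρ, hball⟩ := nhds_basis_closedBall.mem_iff.1 ((isOpen_sector m).mem_nhds hp)
  let φ : ContDiffBump p := ⟨ρ / 2, ρ, by positivity, by linarith⟩
  have hφsupp : tsupport φ ⊆ sector m := φ.tsupport_eq.trans_subset hball
  have hφs : ContDiff ℝ (⊤ : ℕ∞) φ := φ.contDiff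
  have hKsub : closedBall p (ρ / 2) ⊆ sector m :=
    (closedBall_subset_closedBall (by linarith)).trans hball
  set D := ∫ x in sector m, ‖gradient φ x‖ ^ 2 with hDdef
  have hD : 0 < D := by
    rw [hDdef, setIntegral_eq_integral_of_forall_compl_eq_zero]
    · refine integral_norm_gradient_sq_pos φ.contDiff φ.hasCompactSupport fun h => ?_
      have h1 : φ p = 1 := φ.one_of_mem_closedBall (mem_closedBall_self φ.rIn_pos.le)
      simp [h] at h1
    · intro x hx
      have h1 : fderiv ℝ φ x = 0 :=
        image_eq_zero_of_notMem_tsupport fun h => hx (hφsupp (tsupport_fderiv_subset ℝ h))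
      simp [norm_gradient, h1]
  set V := volume.real (closedBall p (ρ / 2)) with hVdef
  have hV : 0 < V := ENNReal.toReal_pos (measure_closedBall_pos volume p (by positivity)).ne'
    measure_closedBall_lt_top.ne
  -- Exponential growth of `F` beats the quadratic Dirichlet energy.
  set c := primF f s₀ * Real.exp (-(M⁻¹ * s₀)) with hcdef
  have hc : 0 < c := mul_pos (hH2 s₀ hs₀.ne').1 (Real.exp_pos _)
  have hlim := (isLittleO_pow_exp_pos_mul_atTop 2 (inv_pos.2 hM)).bound
    (show 0 < c * V / D by positivity)
  have hlim2 : ∀ᶠ t : ℝ in atTop, r ^ 2 / D < t ^ 2 :=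
    (tendsto_pow_atTop two_ne_zero).eventually_gt_atTop _
  obtain ⟨t, ⟨ht1, ht2⟩, ht3⟩ := ((hlim.and hlim2).and (eventually_ge_atTop s₀)).exists
  have ht0 : 0 < t := hs₀.trans_le ht3
  have hgrad : ∫ x in sector m, ‖gradient (fun y => t * φ y) x‖ ^ 2 = t ^ 2 * D := by
    rw [hDdef, ← integral_const_mul]
    congr 1 with x
    rw [norm_gradient, norm_gradient,
      fderiv_const_mul ((hφs.differentiable (by simp)) x), norm_smul, mul_pow,
      Real.norm_eq_abs, sq_abs]
  have hsupp : tsupport (fun y => t * φ y) ⊆ tsupport φ := tsupport_mul_subset_right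
  refine ⟨fun y => t * φ y, contDiff_const.mul hφs, φ.hasCompactSupport.mul_left,
    hsupp.trans hφsupp, ?_, ?_⟩
  · rwa [hgrad, ← div_lt_iff₀ hD]
  · have hint : Integrable (fun x => primF f (t * φ x)) := by
      refine Continuous.integrable_of_hasCompactSupport
        ((continuous_primF hcont).comp (continuous_const.mul φ.continuous)) ?_
      exact (φ.hasCompactSupport.mul_left (f := fun _ => t)).comp_left (primF_zero f)
    have hlow : V * primF f t ≤ ∫ x in sector m, primF f (t * φ x) := by
      calc V * primF f t = ∫ x in closedBall p (ρ / 2), primF f (t * φ x) := by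
            rw [setIntegral_congr_fun (g := fun _ => primF f t) measurableSet_closedBall]
            · simp [hVdef]
            · intro x hx
              simp [φ.one_of_mem_closedBall hx]
        _ ≤ _ := setIntegral_mono_set hint.integrableOn
            (ae_of_all _ fun x => hFnonneg _) hKsub.eventuallyLE
    have hFt : c * Real.exp (M⁻¹ * t) ≤ primF f t := hgrowth t ht3
    have hquad : t ^ 2 * D ≤ V * primF f t := by
      rw [Real.norm_of_nonneg (by positivity), Real.norm_of_nonneg (Real.exp_pos _).le,
        div_mul_eq_mul_div, le_div_iff₀ hD] at ht1
      nlinarith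
    have hpos : 0 < t ^ 2 * D := by positivity
    rw [energy, hgrad]
    linarith
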